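/- There exists a universal constant C > 0 with the following property. Let T ≥ 1, let J ⊆ [0, T] be an interval, let A, N be positive integers with 4A ≤ N, and let a ∈ ℤ² with |a| ≤ A. Let f : ℝ × ℝ × ℤ² → ℂ be such that for each t ∈ [0, T] and each n ∈ ℤ² with N/2 ≤ |n| ≤ 2N, the map t' ↦ f(t', t, n) is continuously differentiable on [0, T], and for all t', t ∈ [0, T] and all such n: |f(t', t, n)| ≤ A·⟨n⟩^{−3}, |f(t', t, n) − f(t', t, −n)| ≤ A·⟨n⟩^{−4}, and |∂_{t'} f(t', t, n)| ≤ A·⟨n⟩^{−3}. Then for every t ∈ [0, T]: | ∑_{n ∈ ℤ², N/2 ≤ |n| ≤ 2N} ∫_0^t 1_J(t') · sin((t − t')·⟨a + n⟩) · cos((t − t')·⟨n⟩) · f(t', t, n) dt' | ≤ C · T² · A² · log(2 + N) · N^{−1}. -/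

import Mathlib

/-- The Euclidean norm of a lattice point `x ∈ ℤ²`. -/
noncomputable def znorm (x : Fin 2 → ℤ) : ℝ :=
  Real.sqrt ((x 0 : ℝ) ^ 2 + (x 1 : ℝ) ^ 2)

/-- The Japanese bracket `⟨x⟩ = √(1 + |x|²)` for lattice points `x ∈ ℤ²`. -/
noncomputable def jb (x : Fin 2 → ℤ) : ℝ :=
  Real.sqrt (1 + (x 0 : ℝ) ^ 2 + (x 1 : ℝ) ^ 2)

/-- `|x| ∼ N`, i.e. `N/2 ≤ |x| ≤ 2N`. -/
def ann (N : ℝ) (x : Fin 2 → ℤ) : Prop :=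
  N / 2 ≤ znorm x ∧ znorm x ≤ 2 * N

open MeasureTheory Set

lemma jb_sq (x : Fin 2 → ℤ) : jb x ^ 2 = 1 + (x 0 : ℝ) ^ 2 + (x 1 : ℝ) ^ 2 :=
  Real.sq_sqrt (by positivity)

lemma znorm_sq (x : Fin 2 → ℤ) : znorm x ^ 2 = (x 0 : ℝ) ^ 2 + (x 1 : ℝ) ^ 2 :=
  Real.sq_sqrt (by positivity)

lemma jb_pos (x : Fin 2 → ℤ) : 0 < jb x := Real.sqrt_pos.2 (by positivity)

lemma znorm_nonneg (x : Fin 2 → ℤ) : 0 ≤ znorm x := Real.sqrt_nonneg _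

lemma znorm_le_jb (x : Fin 2 → ℤ) : znorm x ≤ jb x :=
  Real.sqrt_le_sqrt (by linarith)

lemma jb_neg (x : Fin 2 → ℤ) : jb (-x) = jb x := by simp [jb]

lemma znorm_neg (x : Fin 2 → ℤ) : znorm (-x) = znorm x := by simp [znorm]

/-- The second difference of the Japanese bracket at `n` in direction `a` is `O(|a|² / ⟨n⟩)`. -/
lemma abs_jb_second_difference_le (a n : Fin 2 → ℤ) :
    |(jb (a + n) - jb n) + (jb (a + -n) - jb n)| ≤ znorm a ^ 2 / jb n := by
  have hp := jb_pos (a + n)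
  have hq := jb_pos (a + -n)
  have hr := jb_pos n
  have hp2 := jb_sq (a + n)
  have hq2 := jb_sq (a + -n)
  have hr2 := jb_sq n
  have ha2 := znorm_sq a
  simp only [Pi.add_apply, Pi.neg_apply, Int.cast_add, Int.cast_neg] at hp2 hq2
  set p := jb (a + n)
  set q := jb (a + -n)
  set r := jb n
  have hpq : r ^ 2 - znorm a ^ 2 ≤ p * q := by
    refine (abs_le_of_sq_le_sq' ?_ (by positivity)).2
    rw [mul_pow, hp2, hq2, hr2, ha2]
    nlinarith [sq_nonneg ((a 0 : ℝ)), sq_nonneg ((a 1 : ℝ)),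
      sq_nonneg ((a 0 : ℝ) * n 1 - a 1 * n 0)]
  rw [abs_le]
  constructor
  · have : 2 * r ≤ p + q := (abs_le_of_sq_le_sq' (by nlinarith) (by positivity)).2
    have : 0 ≤ znorm a ^ 2 / r := by positivity
    linarith
  · have h : p + q ≤ 2 * r + znorm a ^ 2 / r := by
      refine (abs_le_of_sq_le_sq' ?_ (by positivity)).2
      have e : (2 * r + znorm a ^ 2 / r) ^ 2
          = 4 * r ^ 2 + 4 * znorm a ^ 2 + (znorm a ^ 2 / r) ^ 2 := by
        field_simp; ring
      rw [e]
      nlinarith [sq_nonneg (p - q), sq_nonneg (znorm a ^ 2 / r)]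
    linarith

/-- Integrating against the indicator of an interval amounts to changing the endpoints. -/
lemma exists_integral_indicator_eq {J : Set ℝ} (hJ : J.OrdConnected) {t : ℝ} (ht : 0 ≤ t) :
    ∃ u v : ℝ, 0 ≤ u ∧ u ≤ v ∧ v ≤ t ∧ ∀ g : ℝ → ℂ,
      ∫ s in (0 : ℝ)..t, J.indicator g s = ∫ s in u..v, g s := by
  set K := J ∩ Ioc 0 t with hK
  have hKc : K.OrdConnected := hJ.inter ordConnected_Ioc
  have hKsub : K ⊆ Ioc 0 t := inter_subset_right
  have key : ∀ g : ℝ → ℂ, ∫ s in (0 : ℝ)..t, J.indicator g s = ∫ s in K, g s := fun g => by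
    rw [intervalIntegral.integral_of_le ht, setIntegral_indicator hJ.measurableSet, inter_comm]
  rcases K.eq_empty_or_nonempty with he | hne
  · exact ⟨0, 0, le_rfl, le_rfl, ht, fun g => by simp [key, he]⟩
  have hbb : BddBelow K := ⟨0, fun x hx => (hKsub hx).1.le⟩
  have hba : BddAbove K := ⟨t, fun x hx => (hKsub hx).2⟩
  have huv : sInf K ≤ sSup K := csInf_le_csSup hne hbb hba
  refine ⟨sInf K, sSup K, le_csInf hne fun x hx => (hKsub hx).1.le, huv,
    csSup_le hne fun x hx => (hKsub hx).2, fun g => ?_⟩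
  rw [key, intervalIntegral.integral_of_le huv]
  refine setIntegral_congr_set ?_
  have h1 : Ioo (sInf K) (sSup K) ⊆ K := fun x hx => by
    obtain ⟨y, hy, hyx⟩ := exists_lt_of_csInf_lt hne hx.1
    obtain ⟨z, hz, hxz⟩ := exists_lt_of_lt_csSup hne hx.2
    exact hKc.out hy hz ⟨hyx.le, hxz.le⟩
  have h2 : K ⊆ Icc (sInf K) (sSup K) := fun x hx => ⟨csInf_le hbb hx, le_csSup hba hx⟩
  have h3 : K ≤ᵐ[volume] Ioc (sInf K) (sSup K) :=
    h2.eventuallyLE.trans Ioc_ae_eq_Icc.symm.le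
  exact h3.antisymm (Ioo_ae_eq_Ioc.symm.le.trans h1.eventuallyLE)

/-- Non-stationary phase: one integration by parts gains a factor of the frequency. -/
lemma norm_integral_sin_mul_le {T M l t u v : ℝ} {g : ℝ → ℂ} (hT : 1 ≤ T) (hl : 0 < l)
    (hu : 0 ≤ u) (huv : u ≤ v) (hv : v ≤ T) (hg : ContDiffOn ℝ 1 g (Icc 0 T))
    (hM : ∀ s ∈ Icc 0 T, ‖g s‖ ≤ M)
    (hM' : ∀ s ∈ Icc 0 T, ‖derivWithin g (Icc 0 T) s‖ ≤ M) :
    ‖∫ s in u..v, ((Real.sin ((t - s) * l) : ℝ) : ℂ) * g s‖ ≤ 3 * T * M / l := by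
  have hsub : Icc u v ⊆ Icc 0 T := Icc_subset_Icc hu hv
  have hM0 : 0 ≤ M := (norm_nonneg _).trans (hM u (hsub ⟨le_rfl, huv⟩))
  have hd : ∀ s ∈ Ioo u v, HasDerivAt g (derivWithin g (Icc 0 T) s) s := fun s hs =>
    ((hg.differentiableOn one_ne_zero s (hsub (Ioo_subset_Icc_self hs))).hasDerivWithinAt).hasDerivAt
      (Icc_mem_nhds (hu.trans_lt hs.1) (hs.2.trans_le hv))
  have hdc : ContinuousOn (derivWithin g (Icc 0 T)) (Icc u v) :=
    (hg.continuousOn_derivWithin (uniqueDiffOn_Icc (by linarith)) le_rfl).mono hsub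
  let c : ℝ → ℂ := fun s => ((Real.cos ((t - s) * l) / l : ℝ) : ℂ)
  have hc : ∀ s, HasDerivAt c ((Real.sin ((t - s) * l) : ℝ) : ℂ) s := fun s => by
    refine HasDerivAt.ofReal_comp ?_
    have h : HasDerivAt (fun s => Real.cos ((t - s) * l) / l)
        (-Real.sin ((t - s) * l) * (-1 * l) / l) s :=
      ((((hasDerivAt_id s).const_sub t).mul_const l).cos).div_const l
    have e : -Real.sin ((t - s) * l) * (-1 * l) / l = Real.sin ((t - s) * l) := by
      field_simp
    rwa [e] at h
  have hcn : ∀ s, ‖c s‖ ≤ 1 / l := fun s => by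
    simp only [c, Complex.norm_real, Real.norm_eq_abs, abs_div, abs_of_pos hl]
    gcongr
    exact Real.abs_cos_le_one _
  have hcc : Continuous c := continuous_iff_continuousAt.2 fun s => (hc s).continuousAt
  have ibp := intervalIntegral.integral_mul_deriv_eq_deriv_mul_of_hasDerivAt (a := u) (b := v)
    (u := c) (v := g) (u' := fun s => ((Real.sin ((t - s) * l) : ℝ) : ℂ))
    (v' := derivWithin g (Icc 0 T)) hcc.continuousOn
    (by rw [uIcc_of_le huv]; exact hg.continuousOn.mono hsub)
    (fun s _ => hc s) (by rw [min_eq_left huv, max_eq_right huv]; exact hd)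
    (by apply Continuous.intervalIntegrable; fun_prop)
    (by apply ContinuousOn.intervalIntegrable; rwa [uIcc_of_le huv])
  have hint : ‖∫ s in u..v, c s * derivWithin g (Icc 0 T) s‖ ≤ (1 / l * M) * |v - u| := by
    refine intervalIntegral.norm_integral_le_of_norm_le_const fun s hs => ?_
    rw [uIoc_of_le huv] at hs
    rw [norm_mul]
    exact mul_le_mul (hcn s) (hM' s (hsub (Ioc_subset_Icc_self hs))) (norm_nonneg _) (by positivity)
  have hb : ∀ s ∈ Icc u v, ‖c s * g s‖ ≤ 1 / l * M := fun s hs => by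
    rw [norm_mul]
    exact mul_le_mul (hcn s) (hM s (hsub hs)) (norm_nonneg _) (by positivity)
  have hb1 := hb v ⟨huv, le_rfl⟩
  have hb2 := hb u ⟨le_rfl, huv⟩
  have e : ∫ s in u..v, ((Real.sin ((t - s) * l) : ℝ) : ℂ) * g s
      = c v * g v - c u * g u - ∫ s in u..v, c s * derivWithin g (Icc 0 T) s := by
    rw [ibp]; ring
  rw [e]
  have h3 := (norm_sub_le (c v * g v - c u * g u)
    (∫ s in u..v, c s * derivWithin g (Icc 0 T) s)).trans
      (add_le_add_left (norm_sub_le _ _) _)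
  rw [abs_of_nonneg (by linarith)] at hint
  have h4 : 1 / l * M * (v - u) ≤ 1 / l * M * T :=
    mul_le_mul_of_nonneg_left (by linarith) (by positivity)
  have h5 : 1 / l * M * 1 ≤ 1 / l * M * T := mul_le_mul_of_nonneg_left hT (by positivity)
  have h6 : 3 * T * M / l = 3 * (1 / l * M * T) := by ring
  linarith

lemma norm_sin_mul_add_sin_mul_le (x y : ℝ) (z w : ℂ) :
    ‖((Real.sin x : ℝ) : ℂ) * z + ((Real.sin y : ℝ) : ℂ) * w‖ ≤ |x + y| * ‖z‖ + ‖z - w‖ := by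
  have e : ((Real.sin x : ℝ) : ℂ) * z + ((Real.sin y : ℝ) : ℂ) * w
      = ((Real.sin x - Real.sin (-y) : ℝ) : ℂ) * z - ((Real.sin y : ℝ) : ℂ) * (z - w) := by
    rw [Real.sin_neg]; push_cast; ring
  rw [e]
  refine (norm_sub_le _ _).trans (add_le_add ?_ ?_)
  · rw [norm_mul, Complex.norm_real, Real.norm_eq_abs]
    refine mul_le_mul_of_nonneg_right ?_ (norm_nonneg _)
    simpa only [sub_neg_eq_add] using Real.abs_sin_sub_sin_le x (-y)
  · rw [norm_mul, Complex.norm_real, Real.norm_eq_abs]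
    exact mul_le_of_le_one_left (norm_nonneg _) (Real.abs_sin_le_one _)

/-- The lattice points of the annulus `N/2 ≤ |n| ≤ 2N` form a finite set of at most `25 N²` points. -/
lemma exists_finset_annulus {N : ℕ} (hN : 0 < N) :
    ∃ S : Finset (Fin 2 → ℤ),
      (∀ n, n ∈ S ↔ (N : ℝ) / 2 ≤ znorm n ∧ znorm n ≤ 2 * (N : ℝ)) ∧
      (S.card : ℝ) ≤ 25 * (N : ℝ) ^ 2 := by
  classical
  set B : Finset (Fin 2 → ℤ) :=
    Fintype.piFinset fun _ => Finset.Icc (-(2 * N : ℤ)) (2 * N) with hB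
  have hmem : ∀ n : Fin 2 → ℤ, znorm n ≤ 2 * (N : ℝ) → n ∈ B := fun n hn => by
    have h2 : (n 0 : ℝ) ^ 2 + (n 1 : ℝ) ^ 2 ≤ (2 * (N : ℝ)) ^ 2 := by
      rw [← znorm_sq]
      exact pow_le_pow_left₀ (znorm_nonneg n) hn 2
    have h : ∀ i, |(n i : ℝ)| ≤ 2 * N := fun i => by
      refine abs_le_of_sq_le_sq ?_ (by positivity)
      fin_cases i <;> simp <;> nlinarith
    rw [hB, Fintype.mem_piFinset]
    intro i
    obtain ⟨h1, h2⟩ := abs_le.1 (h i)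
    rw [Finset.mem_Icc]
    exact ⟨by exact_mod_cast h1, by exact_mod_cast h2⟩
  refine ⟨B.filter fun n => (N : ℝ) / 2 ≤ znorm n ∧ znorm n ≤ 2 * (N : ℝ),
    fun n => ⟨fun h => (Finset.mem_filter.1 h).2,
      fun h => Finset.mem_filter.2 ⟨hmem n h.2, h⟩⟩, ?_⟩
  have hcard : B.card = (4 * N + 1) ^ 2 := by
    rw [hB, Fintype.card_piFinset_const, Int.card_Icc]
    congr 1
    omega
  have h1 : (B.filter fun n => (N : ℝ) / 2 ≤ znorm n ∧ znorm n ≤ 2 * (N : ℝ)).card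
      ≤ (4 * N + 1) ^ 2 := hcard ▸ Finset.card_filter_le _ _
  have h2 : (4 * N + 1) ^ 2 ≤ 25 * N ^ 2 := by nlinarith
  exact_mod_cast h1.trans h2

/-- Symmetrising a finite sum over a set invariant under negation. -/
lemma norm_sum_le_of_add_neg {S : Finset (Fin 2 → ℤ)} (hS : ∀ n ∈ S, -n ∈ S)
    {F : (Fin 2 → ℤ) → ℂ} {b : ℝ} (hF : ∀ n ∈ S, ‖F n + F (-n)‖ ≤ 2 * b) :
    ‖∑ n ∈ S, F n‖ ≤ S.card * b := by
  have h : ∑ n ∈ S, F (-n) = ∑ n ∈ S, F n :=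
    Finset.sum_nbij' (fun n => -n) (fun n => -n) hS hS (by simp) (by simp) (by simp)
  have h2 : ‖∑ n ∈ S, (F n + F (-n))‖ ≤ S.card * (2 * b) := by
    simpa using norm_sum_le_of_le S hF
  rw [Finset.sum_add_distrib, h, ← two_mul, norm_mul] at h2
  norm_num at h2
  linarith

/-- sine-cancellation lemma: there is a universal `C > 0` such that for every
`T ≥ 1`, every interval `J ⊆ [0,T]`, positive integers `A, N` with `4A ≤ N`, every `a ∈ ℤ²`
with `|a| ≤ A`, and every `f : ℝ × ℝ × ℤ² → ℂ` which, for each `t ∈ [0,T]` and each `n` with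
`N/2 ≤ |n| ≤ 2N`, is `C¹` in `t'` on `[0,T]` and satisfies `|f| ≤ A⟨n⟩^{-3}`,
`|f(t',t,n) − f(t',t,−n)| ≤ A⟨n⟩^{-4}` and `|∂_{t'} f| ≤ A⟨n⟩^{-3}`, one has for every
`t ∈ [0,T]`:
`|∑_{N/2 ≤ |n| ≤ 2N} ∫₀ᵗ 1_J(t') sin((t−t')⟨a+n⟩) cos((t−t')⟨n⟩) f(t',t,n) dt'|
  ≤ C T² A² log(2+N) N^{-1}`. -/
theorem sine_cancellation :
    ∃ C : ℝ, 0 < C ∧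
      ∀ (T : ℝ), 1 ≤ T →
      ∀ (J : Set ℝ), J.OrdConnected → J ⊆ Set.Icc 0 T →
      ∀ (A N : ℕ), 0 < A → 0 < N → 4 * A ≤ N →
      ∀ (a : Fin 2 → ℤ), znorm a ≤ (A : ℝ) →
      ∀ (f : ℝ → ℝ → (Fin 2 → ℤ) → ℂ),
        (∀ t ∈ Set.Icc (0:ℝ) T, ∀ n : Fin 2 → ℤ,
            (N : ℝ) / 2 ≤ znorm n → znorm n ≤ 2 * (N : ℝ) →
            ContDiffOn ℝ 1 (fun t' => f t' t n) (Set.Icc (0:ℝ) T)) →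
        (∀ t ∈ Set.Icc (0:ℝ) T, ∀ t' ∈ Set.Icc (0:ℝ) T, ∀ n : Fin 2 → ℤ,
            (N : ℝ) / 2 ≤ znorm n → znorm n ≤ 2 * (N : ℝ) →
            ‖f t' t n‖ ≤ (A : ℝ) * jb n ^ (-3 : ℝ) ∧
            ‖f t' t n - f t' t (-n)‖ ≤ (A : ℝ) * jb n ^ (-4 : ℝ) ∧
            ‖derivWithin (fun s => f s t n) (Set.Icc (0:ℝ) T) t'‖ ≤
              (A : ℝ) * jb n ^ (-3 : ℝ)) →
        ∀ t ∈ Set.Icc (0:ℝ) T,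
          ‖∑' n : Fin 2 → ℤ,
              Set.indicator
                {n : Fin 2 → ℤ | (N : ℝ) / 2 ≤ znorm n ∧ znorm n ≤ 2 * (N : ℝ)}
                (fun n => ∫ t' in (0:ℝ)..t,
                  ((Set.indicator J (fun _ => (1:ℝ)) t' *
                    Real.sin ((t - t') * jb (a + n)) *
                    Real.cos ((t - t') * jb n) : ℝ) : ℂ) * f t' t n) n‖ ≤
            C * T ^ 2 * (A : ℝ) ^ 2 * Real.log (2 + (N : ℝ)) / (N : ℝ) := by
  refine ⟨1000, by norm_num, ?_⟩
  intro T hT J hJ _ A N hA hN hAN a ha f hf hbd t ht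
  obtain ⟨S, hS, hcard⟩ := exists_finset_annulus hN
  obtain ⟨u, v, hu, huv, hvt, hint⟩ := exists_integral_indicator_eq hJ ht.1
  have hvT : v ≤ T := hvt.trans ht.2
  have hsub : Icc u v ⊆ Icc 0 T := Icc_subset_Icc hu hvT
  have hN' : (0 : ℝ) < N := by exact_mod_cast hN
  have hA' : (1 : ℝ) ≤ A := by exact_mod_cast hA
  have hAN' : (A : ℝ) ≤ N := by exact_mod_cast (by omega : A ≤ N)
  have hneg : ∀ n ∈ S, -n ∈ S := fun n hn => by
    rw [hS, znorm_neg]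
    exact (hS n).1 hn
  have hjb : ∀ n ∈ S, (N : ℝ) / 2 ≤ jb n := fun n hn =>
    ((hS n).1 hn).1.trans (znorm_le_jb n)
  have hpow : ∀ n ∈ S, ∀ k : ℕ, jb n ^ (-(k : ℝ)) ≤ 2 ^ k / (N : ℝ) ^ k := fun n hn k => by
    rw [Real.rpow_neg (jb_pos n).le, Real.rpow_natCast, ← div_pow, ← inv_div, inv_pow]
    exact inv_anti₀ (by positivity) (pow_le_pow_left₀ (by positivity) (hjb n hn) k)
  have hf0 : ∀ n ∈ S, ∀ s ∈ Icc 0 T, ‖f s t n‖ ≤ 8 * A / (N : ℝ) ^ 3 := fun n hn s hs => by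
    refine (hbd t ht s hs n ((hS n).1 hn).1 ((hS n).1 hn).2).1.trans ?_
    have h := mul_le_mul_of_nonneg_left (hpow n hn 3) (Nat.cast_nonneg (α := ℝ) A)
    norm_num at h ⊢
    exact h.trans_eq (by ring)
  have hf1 : ∀ n ∈ S, ∀ s ∈ Icc 0 T, ‖f s t n - f s t (-n)‖ ≤ 16 * A / (N : ℝ) ^ 4 :=
      fun n hn s hs => by
    refine (hbd t ht s hs n ((hS n).1 hn).1 ((hS n).1 hn).2).2.1.trans ?_
    have h := mul_le_mul_of_nonneg_left (hpow n hn 4) (Nat.cast_nonneg (α := ℝ) A)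
    norm_num at h ⊢
    exact h.trans_eq (by ring)
  have hf2 : ∀ n ∈ S, ∀ s ∈ Icc 0 T,
      ‖derivWithin (fun s => f s t n) (Icc 0 T) s‖ ≤ 8 * A / (N : ℝ) ^ 3 := fun n hn s hs => by
    refine (hbd t ht s hs n ((hS n).1 hn).1 ((hS n).1 hn).2).2.2.trans ?_
    have h := mul_le_mul_of_nonneg_left (hpow n hn 3) (Nat.cast_nonneg (α := ℝ) A)
    norm_num at h ⊢
    exact h.trans_eq (by ring)
  have hfc : ∀ n ∈ S, ContDiffOn ℝ 1 (fun s => f s t n) (Icc 0 T) := fun n hn =>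
    hf t ht n ((hS n).1 hn).1 ((hS n).1 hn).2
  let P : ℝ → (Fin 2 → ℤ) → ℂ := fun l n =>
    ∫ s in u..v, ((Real.sin ((t - s) * l) : ℝ) : ℂ) * f s t n
  have hii : ∀ n ∈ S, ∀ l : ℝ, IntervalIntegrable
      (fun s => ((Real.sin ((t - s) * l) : ℝ) : ℂ) * f s t n) volume u v := fun n hn l => by
    apply ContinuousOn.intervalIntegrable
    rw [uIcc_of_le huv]
    exact ContinuousOn.mul (by fun_prop) ((hfc n hn).continuousOn.mono hsub)
  have hsplit : ∀ n ∈ S, (∫ s in (0:ℝ)..t,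
      ((Set.indicator J (fun _ => (1:ℝ)) s * Real.sin ((t - s) * jb (a + n)) *
        Real.cos ((t - s) * jb n) : ℝ) : ℂ) * f s t n)
      = (1 / 2) * P (jb (a + n) + jb n) n + (1 / 2) * P (jb (a + n) - jb n) n := fun n hn => by
    have e : ∀ s, ((Set.indicator J (fun _ => (1:ℝ)) s * Real.sin ((t - s) * jb (a + n)) *
        Real.cos ((t - s) * jb n) : ℝ) : ℂ) * f s t n
        = J.indicator (fun s => (1 / 2 : ℂ) *
          (((Real.sin ((t - s) * (jb (a + n) + jb n)) : ℝ) : ℂ) * f s t n +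
          ((Real.sin ((t - s) * (jb (a + n) - jb n)) : ℝ) : ℂ) * f s t n)) s := fun s => by
      by_cases hs : s ∈ J
      · simp only [indicator_of_mem hs, mul_add, mul_sub, Real.sin_add, Real.sin_sub]
        push_cast
        ring
      · simp [indicator_of_notMem hs]
    simp_rw [e]
    rw [hint, intervalIntegral.integral_const_mul,
      intervalIntegral.integral_add (hii n hn _) (hii n hn _), mul_add]
  set b : ℝ := T ^ 2 * A ^ 3 / (N : ℝ) ^ 4 with hb
  have hTA : T * A / (N : ℝ) ^ 4 ≤ b := by
    rw [hb]
    gcongr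
    · exact le_self_pow₀ hT two_ne_zero
    · exact le_self_pow₀ hA' three_ne_zero
  have hhigh : ∀ n ∈ S, ‖(1 / 2) * P (jb (a + n) + jb n) n‖ ≤ 24 * b := fun n hn => by
    have hl : (N : ℝ) / 2 ≤ jb (a + n) + jb n := (hjb n hn).trans (by linarith [jb_pos (a + n)])
    have h := norm_integral_sin_mul_le (t := t) hT (lt_of_lt_of_le (by positivity) hl) hu huv hvT
      (hfc n hn) (hf0 n hn) (hf2 n hn)
    have h' : 3 * T * (8 * A / (N : ℝ) ^ 3) / (jb (a + n) + jb n)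
        ≤ 3 * T * (8 * A / (N : ℝ) ^ 3) / (N / 2) := by gcongr
    have h'' : 3 * T * (8 * A / (N : ℝ) ^ 3) / (N / 2) = 48 * (T * A / (N : ℝ) ^ 4) := by
      field_simp; ring
    rw [norm_mul]
    norm_num
    linarith
  have hlow : ∀ n ∈ S, ‖(1 / 2) * P (jb (a + n) - jb n) n
      + (1 / 2) * P (jb (a + -n) - jb (-n)) (-n)‖ ≤ 2 * (8 * b) := fun n hn => by
    rw [← mul_add, jb_neg]
    simp only [P]
    rw [← intervalIntegral.integral_add (hii n hn _) (hii (-n) (hneg n hn) _)]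
    have hph : |(jb (a + n) - jb n) + (jb (a + -n) - jb n)| ≤ 2 * A ^ 2 / N := by
      refine (abs_jb_second_difference_le a n).trans ?_
      have : (A : ℝ) ^ 2 / (N / 2) = 2 * A ^ 2 / N := by field_simp
      rw [← this]
      have := znorm_nonneg a
      have := hjb n hn
      gcongr
    have h := intervalIntegral.norm_integral_le_of_norm_le_const (a := u) (b := v)
      (C := T * (2 * A ^ 2 / N) * (8 * A / (N : ℝ) ^ 3) + 16 * A / (N : ℝ) ^ 4)
      (f := fun s => ((Real.sin ((t - s) * (jb (a + n) - jb n)) : ℝ) : ℂ) * f s t n +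
        ((Real.sin ((t - s) * (jb (a + -n) - jb n)) : ℝ) : ℂ) * f s t (-n)) fun s hs => by
        rw [uIoc_of_le huv] at hs
        have hsT := hsub (Ioc_subset_Icc_self hs)
        refine (norm_sin_mul_add_sin_mul_le _ _ _ _).trans (add_le_add ?_ (hf1 n hn s hsT))
        rw [← mul_add, abs_mul]
        have hts : |t - s| ≤ T := by
          rw [abs_le]; constructor <;> linarith [hsT.1, hsT.2, ht.1, ht.2]
        have := hf0 n hn s hsT
        gcongr
    have hvu : |v - u| ≤ T := by rw [abs_of_nonneg] <;> linarith
    have h' := h.trans (mul_le_mul_of_nonneg_left hvu (by positivity))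
    have e : (T * (2 * A ^ 2 / N) * (8 * A / (N : ℝ) ^ 3) + 16 * A / (N : ℝ) ^ 4) * T
        = 16 * b + 16 * (T * A / (N : ℝ) ^ 4) := by
      rw [hb]; field_simp; ring
    rw [norm_mul]
    norm_num at h' ⊢
    linarith
  have hSset : {n : Fin 2 → ℤ | (N : ℝ) / 2 ≤ znorm n ∧ znorm n ≤ 2 * (N : ℝ)} = S :=
    Set.ext fun n => (hS n).symm
  rw [hSset, ← sum_eq_tsum_indicator, Finset.sum_congr rfl hsplit,
    Finset.sum_add_distrib]
  have h1 : ‖∑ n ∈ S, (1 / 2) * P (jb (a + n) + jb n) n‖ ≤ S.card * (24 * b) := by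
    simpa using norm_sum_le_of_le S hhigh
  have h2 := norm_sum_le_of_add_neg hneg hlow
  have h3 : (S.card : ℝ) * (32 * b) ≤ 25 * (N : ℝ) ^ 2 * (32 * b) :=
    mul_le_mul_of_nonneg_right hcard (by positivity)
  have h4 : 25 * (N : ℝ) ^ 2 * (32 * b) = 800 * (T ^ 2 * A ^ 2 / N) * (A / N) := by
    rw [hb]; field_simp; ring
  have h5 : 800 * (T ^ 2 * A ^ 2 / N) * (A / N) ≤ 800 * (T ^ 2 * A ^ 2 / N) :=
    mul_le_of_le_one_right (by positivity) ((div_le_one hN').2 hAN')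
  have hlog : 1 ≤ Real.log (2 + (N : ℝ)) := by
    rw [Real.le_log_iff_exp_le (by positivity)]
    have : (1 : ℝ) ≤ N := by exact_mod_cast hN
    linarith [Real.exp_one_lt_d9]
  have h6 : T ^ 2 * A ^ 2 / (N : ℝ) * 1 ≤ T ^ 2 * A ^ 2 / N * Real.log (2 + (N : ℝ)) :=
    mul_le_mul_of_nonneg_left hlog (by positivity)
  have h7 : 1000 * T ^ 2 * (A : ℝ) ^ 2 * Real.log (2 + (N : ℝ)) / (N : ℝ)
      = 1000 * (T ^ 2 * A ^ 2 / N * Real.log (2 + (N : ℝ))) := by ring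
  have h8 : 0 ≤ T ^ 2 * A ^ 2 / (N : ℝ) := by positivity
  rw [h7]
  refine (norm_add_le _ _).trans ?_
  linarith
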